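/- arXiv:1102.2053 — 3 statements merged into one kernel-verified Lean document; each statement's English description precedes it below -/
import Mathlib

section
/- Let f be a conditional density of the vector (X_{t+k},…,X_{t+k+r₂}) given (X_t,…,X_{t−r₁}). Then for all r₁, r₂ ≥ 0 and every vector η = (η_0,…,η_{r₁}) of positive reals, sup over H ∈ σ(X_t,…,X_{t−r₁}) and G ∈ σ(X_{t+k},…,X_{t+k+r₂}) of |P(G ∩ H) − P(G)P(H)| is at most 2·sup_{x ∈ ℰ} ∫_{ℝ^{r₂+1}} |f(y|x) − f(y|0)| dy + 4·P(Eᶜ). -/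
open MeasureTheory

/-- The integrals of two nonnegative functions over a set differ by at most their `L¹` distance. -/
theorem setLIntegral_ofReal_le_add_lintegral_abs_sub {α : Type*} [MeasurableSpace α]
    {ν : Measure α} {g h : α → ℝ} (hh : Measurable h) (A : Set α) :
    ∫⁻ y in A, ENNReal.ofReal (g y) ∂ν ≤
      ∫⁻ y in A, ENNReal.ofReal (h y) ∂ν + ∫⁻ y, ENNReal.ofReal |g y - h y| ∂ν := by
  calc ∫⁻ y in A, ENNReal.ofReal (g y) ∂ν
      ≤ ∫⁻ y in A, (ENNReal.ofReal (h y) + ENNReal.ofReal |g y - h y|) ∂ν := by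
        refine lintegral_mono fun y => ?_
        refine le_trans (ENNReal.ofReal_le_ofReal ?_) ENNReal.ofReal_add_le
        linarith [le_abs_self (g y - h y)]
    _ = ∫⁻ y in A, ENNReal.ofReal (h y) ∂ν + ∫⁻ y in A, ENNReal.ofReal |g y - h y| ∂ν :=
        lintegral_add_left hh.ennreal_ofReal _
    _ ≤ _ := by gcongr; exact Measure.restrict_le_self

/-- If a function stays within `S` of the constant `q` on `s`, then its integral over `s`
is within `S * μ s` of `q * μ s`. -/
theorem setLIntegral_near_const {α : Type*} [MeasurableSpace α] {μ : Measure α}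
    {s : Set α} (hs : MeasurableSet s) {κ : α → ENNReal} {q S : ENNReal}
    (hle : ∀ x ∈ s, κ x ≤ q + S) (hge : ∀ x ∈ s, q ≤ κ x + S) :
    ∫⁻ x in s, κ x ∂μ ≤ q * μ s + S * μ s ∧ q * μ s ≤ ∫⁻ x in s, κ x ∂μ + S * μ s := by
  constructor
  · calc ∫⁻ x in s, κ x ∂μ ≤ ∫⁻ _ in s, (q + S) ∂μ := setLIntegral_mono' hs hle
      _ = q * μ s + S * μ s := by rw [setLIntegral_const, add_mul]
  · calc q * μ s = ∫⁻ _ in s, q ∂μ := (setLIntegral_const s q).symm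
      _ ≤ ∫⁻ x in s, (κ x + S) ∂μ := setLIntegral_mono' hs hge
      _ = ∫⁻ x in s, κ x ∂μ + S * μ s := by
        rw [lintegral_add_right _ measurable_const, setLIntegral_const]

/-- If the conditional weight of `G` on `E` is within `S` of `q`, both globally and on `H`, then
`G` and `H` are independent up to `2 * S + 4 * P Eᶜ`. -/
theorem abs_measure_inter_sub_mul_le {Ω : Type*} [MeasurableSpace Ω] (P : Measure Ω)
    [IsProbabilityMeasure P] {E : Set Ω} (hE : MeasurableSet E) (G H : Set Ω) {q S : ENNReal}
    (hGHE : P (G ∩ (H ∩ E)) ≤ q * P (H ∩ E) + S * P (H ∩ E))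
    (hGHE' : q * P (H ∩ E) ≤ P (G ∩ (H ∩ E)) + S * P (H ∩ E))
    (hGE : P (G ∩ E) ≤ q * P E + S * P E) (hGE' : q * P E ≤ P (G ∩ E) + S * P E) :
    ENNReal.ofReal |(P (G ∩ H)).toReal - (P G).toReal * (P H).toReal| ≤ 2 * S + 4 * P Eᶜ := by
  rcases eq_or_ne S ⊤ with rfl | hS
  · simp
  have hsplit : ∀ T : Set Ω, P.real (T ∩ E) ≤ P.real T ∧
      P.real T ≤ P.real (T ∩ E) + P.real Eᶜ := fun T => by
    have h₁ := measureReal_inter_add_sdiff (μ := P) (s := T) hE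
    have h₂ : P.real (T \ E) ≤ P.real Eᶜ := measureReal_mono fun _ hx => hx.2
    have h₃ : 0 ≤ P.real (T \ E) := measureReal_nonneg
    constructor <;> linarith
  have hrhs : 2 * S + 4 * P Eᶜ = ENNReal.ofReal (2 * S.toReal + 4 * P.real Eᶜ) := by
    rw [ENNReal.ofReal_add (by positivity) (by positivity), ENNReal.ofReal_mul (by positivity),
      ENNReal.ofReal_mul (by positivity), ENNReal.ofReal_toReal hS, ofReal_measureReal]
    simp
  rw [hrhs]
  refine ENNReal.ofReal_le_ofReal ?_
  change |P.real (G ∩ H) - P.real G * P.real H| ≤ _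
  have hcompl : P.real Eᶜ = 1 - P.real E := by rw [probReal_compl_eq_one_sub hE]
  have hS0 : 0 ≤ S.toReal := ENNReal.toReal_nonneg
  have hGle : P.real G ≤ 1 := measureReal_le_one
  have hHle : P.real H ≤ 1 := measureReal_le_one
  have hGHle : P.real (G ∩ H) ≤ 1 := measureReal_le_one
  have hG0 : 0 ≤ P.real G := measureReal_nonneg
  have hH0 : 0 ≤ P.real H := measureReal_nonneg
  have hGH0 : 0 ≤ P.real (G ∩ H) := measureReal_nonneg
  rcases eq_or_ne (P E) 0 with hE0 | hE0
  · have : P.real E = 0 := by simp [measureReal_def, hE0]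
    rw [abs_le]
    constructor <;> nlinarith [mul_nonneg hG0 hH0, mul_le_one₀ hGle hH0 hHle]
  have hq : q ≠ ⊤ := by
    rintro rfl
    rw [ENNReal.top_mul hE0, top_le_iff] at hGE'
    exact ENNReal.add_ne_top.2
      ⟨measure_ne_top P _, ENNReal.mul_ne_top hS (measure_ne_top P _)⟩ hGE'
  have hreal_le : ∀ T U : Set Ω, P T ≤ q * P U + S * P U →
      P.real T ≤ q.toReal * P.real U + S.toReal * P.real U := fun T U h => by
    have hqU := ENNReal.mul_ne_top hq (measure_ne_top P U)
    have hSU := ENNReal.mul_ne_top hS (measure_ne_top P U)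
    simpa [ENNReal.toReal_add hqU hSU, measureReal_def] using
      ENNReal.toReal_mono (ENNReal.add_ne_top.2 ⟨hqU, hSU⟩) h
  have hreal_ge : ∀ T U : Set Ω, q * P U ≤ P T + S * P U →
      q.toReal * P.real U ≤ P.real T + S.toReal * P.real U := fun T U h => by
    have hSU := ENNReal.mul_ne_top hS (measure_ne_top P U)
    simpa [ENNReal.toReal_add (measure_ne_top P T) hSU, measureReal_def] using
      ENNReal.toReal_mono (ENNReal.add_ne_top.2 ⟨measure_ne_top P T, hSU⟩) h
  replace hGHE := hreal_le _ _ hGHE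
  replace hGHE' := hreal_ge _ _ hGHE'
  replace hGE := hreal_le _ _ hGE
  replace hGE' := hreal_ge _ _ hGE'
  obtain ⟨hG₁, hG₂⟩ := hsplit G
  obtain ⟨hH₁, hH₂⟩ := hsplit H
  obtain ⟨hGH₁, hGH₂⟩ := hsplit (G ∩ H)
  rw [Set.inter_assoc] at hGH₁ hGH₂
  have he0 : 0 ≤ P.real E := measureReal_nonneg
  have he1 : P.real E ≤ 1 := measureReal_le_one
  have ha0 : 0 ≤ P.real (G ∩ (H ∩ E)) := measureReal_nonneg
  have hb0 : 0 ≤ P.real (G ∩ E) := measureReal_nonneg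
  have hh0 : 0 ≤ P.real (H ∩ E) := measureReal_nonneg
  generalize P.real (G ∩ (H ∩ E)) = a at *
  generalize P.real (G ∩ E) = b at *
  generalize P.real (H ∩ E) = h at *
  generalize P.real (G ∩ H) = gh at *
  generalize P.real G = g at *
  generalize P.real H = h' at *
  generalize P.real Eᶜ = ε at *
  generalize P.real E = e at *
  generalize S.toReal = s at *
  generalize q.toReal = r at *
  have hhe : h * e ≤ 1 := mul_le_one₀ (by linarith) he0 he1
  have hshe : s * (h * e) ≤ s := mul_le_of_le_one_right hS0 hhe
  have haε : a * ε ≤ ε := mul_le_of_le_one_left (by linarith) (by linarith)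
  have haε0 : 0 ≤ a * ε := mul_nonneg ha0 (by linarith)
  have hbh : b * h ≤ g * h' := mul_le_mul hG₁ hH₁ hh0 hG0
  have hgh : g * h' ≤ b * h + 2 * ε := by
    nlinarith [mul_le_mul_of_nonneg_right hG₂ hH0, mul_le_mul_of_nonneg_left hH₂ hb0]
  have hsplit_a : a = a * e + a * ε := by rw [hcompl]; ring
  have hupper : a * e - b * h ≤ 2 * s := by
    linear_combination 2 * hshe + mul_le_mul_of_nonneg_right hGHE he0 +
      mul_le_mul_of_nonneg_right hGE' hh0
  have hlower : b * h - a * e ≤ 2 * s := by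
    linear_combination 2 * hshe + mul_le_mul_of_nonneg_right hGHE' he0 +
      mul_le_mul_of_nonneg_right hGE hh0
  rw [abs_le]
  constructor <;> linarith

/-- Proposition 2.1, inequality (5): for any stochastic process `X`, if `f` is a conditional
density of `(X_{t+k},…,X_{t+k+r₂})` given `(X_t,…,X_{t−r₁})`, then for every vector `η` of
positive reals (defining the set `E`), and all `H ∈ σ(X_t,…,X_{t−r₁})`,
`G ∈ σ(X_{t+k},…,X_{t+k+r₂})`,
`|P(G ∩ H) − P(G)P(H)| ≤ 2 sup_{x ∈ ℰ} ∫ |f(y|x) − f(y|0)| dy + 4 P(Eᶜ)`. -/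
theorem arch_mixing_stmt0
    {Ω : Type*} [MeasurableSpace Ω] (P : Measure Ω) [IsProbabilityMeasure P]
    (X : ℤ → Ω → ℝ) (hX : ∀ s, Measurable (X s))
    (t k : ℤ) (hk : 1 ≤ k) (r₁ r₂ : ℕ)
    (Xpast : Ω → Fin (r₁ + 1) → ℝ) (hXpast : Xpast = fun ω (j : Fin (r₁ + 1)) => X (t - (j : ℕ)) ω)
    (Xfut : Ω → Fin (r₂ + 1) → ℝ) (hXfut : Xfut = fun ω (j : Fin (r₂ + 1)) => X (t + k + (j : ℕ)) ω)
    (f : (Fin (r₂ + 1) → ℝ) → (Fin (r₁ + 1) → ℝ) → ℝ)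
    (hf_nonneg : ∀ y x, 0 ≤ f y x)
    (hf_meas : Measurable (Function.uncurry f))
    (hdens : ∀ (A : Set (Fin (r₂ + 1) → ℝ)) (B : Set (Fin (r₁ + 1) → ℝ)),
      MeasurableSet A → MeasurableSet B →
      P (Xfut ⁻¹' A ∩ Xpast ⁻¹' B)
        = ∫⁻ x in B, ∫⁻ y in A, ENNReal.ofReal (f y x) ∂volume ∂(Measure.map Xpast P))
    (η : Fin (r₁ + 1) → ℝ) (hη : ∀ j, 0 < η j)
    (𝓔 : Set (Fin (r₁ + 1) → ℝ)) (h𝓔 : 𝓔 = {x | ∀ j, |x j| ≤ η j})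
    (E : Set Ω) (hE : E = Xpast ⁻¹' 𝓔) :
    ∀ G H : Set Ω,
      MeasurableSet[MeasurableSpace.comap Xfut inferInstance] G →
      MeasurableSet[MeasurableSpace.comap Xpast inferInstance] H →
      ENNReal.ofReal |(P (G ∩ H)).toReal - (P G).toReal * (P H).toReal|
        ≤ 2 * (⨆ x ∈ 𝓔, ∫⁻ y, ENNReal.ofReal |f y x - f y 0|)
          + 4 * P Eᶜ := by
  rintro G H ⟨A, hA, rfl⟩ ⟨B, hB, rfl⟩
  have hmpast : Measurable Xpast := by
    rw [hXpast]; exact measurable_pi_lambda _ fun j => hX _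
  have hm𝓔 : MeasurableSet 𝓔 := by
    have : 𝓔 = ⋂ j, {x | |x j| ≤ η j} := by ext x; simp [h𝓔]
    rw [this]
    exact MeasurableSet.iInter fun j =>
      measurableSet_le (measurable_pi_apply j).abs measurable_const
  have hm : ∀ x, Measurable fun y => f y x := fun x => hf_meas.comp measurable_prodMk_right
  set S := ⨆ x ∈ 𝓔, ∫⁻ y, ENNReal.ofReal |f y x - f y 0| with hS
  have hSle : ∀ x ∈ 𝓔, ∫⁻ y, ENNReal.ofReal |f y x - f y 0| ≤ S := fun x hx =>
    le_iSup₂_of_le x hx le_rfl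
  have key : ∀ C : Set (Fin (r₁ + 1) → ℝ), MeasurableSet C → C ⊆ 𝓔 →
      P (Xfut ⁻¹' A ∩ Xpast ⁻¹' C) ≤
        (∫⁻ y in A, ENNReal.ofReal (f y 0)) * P (Xpast ⁻¹' C) + S * P (Xpast ⁻¹' C) ∧
      (∫⁻ y in A, ENNReal.ofReal (f y 0)) * P (Xpast ⁻¹' C) ≤
        P (Xfut ⁻¹' A ∩ Xpast ⁻¹' C) + S * P (Xpast ⁻¹' C) := fun C hC hC𝓔 => by
    rw [hdens A C hA hC, ← Measure.map_apply hmpast hC]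
    refine setLIntegral_near_const hC (fun x hx => ?_) fun x hx => ?_
    · exact (setLIntegral_ofReal_le_add_lintegral_abs_sub (hm 0) A).trans
        (add_le_add_right (hSle x (hC𝓔 hx)) _)
    · refine (setLIntegral_ofReal_le_add_lintegral_abs_sub (hm x) A).trans
        (add_le_add_right ?_ _)
      simpa only [abs_sub_comm] using hSle x (hC𝓔 hx)
  subst hE
  obtain ⟨h₁, h₂⟩ := key (B ∩ 𝓔) (hB.inter hm𝓔) Set.inter_subset_right
  obtain ⟨h₃, h₄⟩ := key 𝓔 hm𝓔 subset_rfl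
  exact abs_measure_inter_sub_mul_le P (hmpast hm𝓔) _ _ h₁ h₂ h₃ h₄
end

section
/- Let W = (W_{t+1},…,W_{t+k−1}) be a random vector with density f_W that is independent of (X_t,…,X_{t−r₁}), let f_{0,k,t} be a conditional density of X_{t+k} given (W, X_t,…,X_{t−r₁}), and for 1 ≤ s ≤ r₂ let f_{s,k,t} be a conditional density of X_{t+k+s} given (X_{t+k},…,X_{t+k+s−1}, W, X_t,…,X_{t−r₁}). Set D_{s,k,t}(y_s | y̲_{s−1}, w, x) = |f_{s,k,t}(y_s | y̲_{s−1}, w, x) − f_{s,k,t}(y_s | y̲_{s−1}, w, 0)| (with no y̲ argument when s = 0). Then sup over H ∈ σ(X_t,…,X_{t−r₁}) and G ∈ σ(X_{t+k},…,X_{t+k+r₂}) of |P(G ∩ H) − P(G)P(H)| is at most 2 Σ_{s=0}^{r₂} sup_{x ∈ ℰ} 𝔼_W( sup_{y̲_{s−1} ∈ ℝ^s} ∫_ℝ D_{s,k,t}(y_s | y̲_{s−1}, W, x) dy_s ) + 4·P(Eᶜ), where 𝔼_W(g(W)) = ∫ g(w) f_W(w) dw. -/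
open MeasureTheory ProbabilityTheory

/-- Pad a finite vector `v : Fin s → ℝ` to a function `ℕ → ℝ` (by zero). -/
noncomputable def padVec (s : ℕ) (v : Fin s → ℝ) : ℕ → ℝ :=
  fun n => if h : n < s then v ⟨n, h⟩ else 0

open scoped ENNReal

theorem ofReal_le_ofReal_add_ofReal_abs_sub (x y : ℝ) :
    ENNReal.ofReal x ≤ ENNReal.ofReal y + ENNReal.ofReal |x - y| :=
  (ENNReal.ofReal_le_ofReal (by linarith [le_abs_self (x - y)])).trans ENNReal.ofReal_add_le

/-- Rescaling a nonnegative function to have mass at most one costs at most twice its `L¹` distance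
to any function of mass at most one. -/
theorem lintegral_rescale_le {α : Type*} [MeasurableSpace α] {μ : Measure α}
    {A B D g : α → ℝ≥0∞} (hD : Measurable D)
    (hAB : ∀ u, A u ≤ B u + D u) (hBA : ∀ u, B u ≤ A u + D u)
    (hg1 : ∀ u, g u ≤ 1) (hA1 : ∫⁻ u, A u ∂μ ≤ 1) :
    (∫⁻ u, A u * g u ∂μ ≤ min 1 (∫⁻ u, B u ∂μ)⁻¹ * ∫⁻ u, B u * g u ∂μ + 2 * ∫⁻ u, D u ∂μ) ∧
    (min 1 (∫⁻ u, B u ∂μ)⁻¹ * ∫⁻ u, B u * g u ∂μ ≤ ∫⁻ u, A u * g u ∂μ + 2 * ∫⁻ u, D u ∂μ) := by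
  set β := ∫⁻ u, B u ∂μ
  set δ := ∫⁻ u, D u ∂μ
  have le_two : δ ≤ 2 * δ := le_mul_of_one_le_left' one_le_two
  have key (F G : α → ℝ≥0∞) (h : ∀ u, F u ≤ G u + D u) :
      ∫⁻ u, F u * g u ∂μ ≤ ∫⁻ u, G u * g u ∂μ + δ := by
    calc ∫⁻ u, F u * g u ∂μ ≤ ∫⁻ u, (G u * g u + D u) ∂μ := by
          refine lintegral_mono fun u => ?_
          calc F u * g u ≤ (G u + D u) * g u := by gcongr; exact h u
            _ ≤ G u * g u + D u := by
              rw [add_mul]; gcongr; exact mul_le_of_le_one_right' (hg1 u)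
      _ = _ := lintegral_add_right _ hD
  have hβδ : β ≤ 1 + δ :=
    calc β ≤ ∫⁻ u, (A u + D u) ∂μ := lintegral_mono hBA
      _ = ∫⁻ u, A u ∂μ + δ := lintegral_add_right _ hD
      _ ≤ 1 + δ := by gcongr
  constructor
  · refine (key A B hAB).trans ?_
    suffices h : ∫⁻ u, B u * g u ∂μ ≤ min 1 β⁻¹ * ∫⁻ u, B u * g u ∂μ + δ by
      calc _ ≤ min 1 β⁻¹ * ∫⁻ u, B u * g u ∂μ + δ + δ := by gcongr
        _ = _ := by rw [two_mul, add_assoc]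
    have hx : ∫⁻ u, B u * g u ∂μ ≤ β :=
      lintegral_mono fun u => mul_le_of_le_one_right' (hg1 u)
    set x := ∫⁻ u, B u * g u ∂μ
    rcases le_total β 1 with h1 | h1
    · rw [min_eq_left (ENNReal.one_le_inv.2 h1), one_mul]
      exact le_self_add
    · rw [min_eq_right (ENNReal.inv_le_one.2 h1)]
      by_cases htop : β = ⊤
      · rw [htop] at hβδ
        have : δ = ⊤ := by
          by_contra hne
          exact (ENNReal.add_lt_top.2 ⟨ENNReal.one_lt_top, lt_top_iff_ne_top.2 hne⟩).not_ge hβδ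
        simp [this]
      · have h0 : β ≠ 0 := (lt_of_lt_of_le one_pos h1).ne'
        calc x = β⁻¹ * x * β := by
              rw [mul_right_comm, ENNReal.inv_mul_cancel h0 htop, one_mul]
          _ ≤ β⁻¹ * x * (1 + δ) := by gcongr
          _ = β⁻¹ * x + β⁻¹ * x * δ := by rw [mul_add, mul_one]
          _ ≤ β⁻¹ * x + δ := by
            gcongr
            refine mul_le_of_le_one_left' ?_
            calc β⁻¹ * x ≤ β⁻¹ * β := by gcongr
              _ = 1 := ENNReal.inv_mul_cancel h0 htop
  · calc _ ≤ 1 * ∫⁻ u, B u * g u ∂μ := by gcongr; exact min_le_left _ _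
      _ ≤ ∫⁻ u, A u * g u ∂μ + δ := by rw [one_mul]; exact key B A hBA
      _ ≤ _ := by gcongr

section Density

variable {Ω : Type*} [MeasurableSpace Ω] {P : Measure Ω} [IsProbabilityMeasure P]
  {α : Type*} [MeasurableSpace α] {V : Ω → α} {U : Ω → ℝ} {a : α × ℝ → ℝ≥0∞}

theorem lintegral_eq_of_condDensity (hV : Measurable V) (hU : Measurable U) (ha : Measurable a)
    (h : ∀ (A : Set ℝ) (B : Set α), MeasurableSet A → MeasurableSet B →
      P (U ⁻¹' A ∩ V ⁻¹' B) = ∫⁻ v in B, ∫⁻ u in A, a (v, u) ∂volume ∂(P.map V))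
    {g : α × ℝ → ℝ≥0∞} (hg : Measurable g) :
    ∫⁻ ω, g (V ω, U ω) ∂P = ∫⁻ ω, ∫⁻ u, a (V ω, u) * g (V ω, u) ∂volume ∂P := by
  have : IsProbabilityMeasure (P.map V) := Measure.isProbabilityMeasure_map hV.aemeasurable
  have : IsProbabilityMeasure (P.map fun ω => (V ω, U ω)) :=
    Measure.isProbabilityMeasure_map (hV.prodMk hU).aemeasurable
  have hlaw : P.map (fun ω => (V ω, U ω)) = ((P.map V).prod volume).withDensity a := by
    refine Measure.ext_prod fun {s t} hs ht => ?_
    rw [Measure.map_apply (hV.prodMk hU) (hs.prod ht), withDensity_apply _ (hs.prod ht),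
      ← Measure.prod_restrict, lintegral_prod _ ha.aemeasurable, ← h t s ht hs]
    congr 1
    ext ω
    simp [and_comm]
  have hag : Measurable fun q => a q * g q := ha.mul hg
  rw [← lintegral_map hg (hV.prodMk hU), hlaw, lintegral_withDensity_eq_lintegral_mul _ ha hg]
  change ∫⁻ q, a q * g q ∂_ = _
  rw [lintegral_prod _ hag.aemeasurable, lintegral_map hag.lintegral_prod_right' hV]

theorem ae_lintegral_condDensity_eq_one (hV : Measurable V) (ha : Measurable a)
    (h : ∀ (A : Set ℝ) (B : Set α), MeasurableSet A → MeasurableSet B →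
      P (U ⁻¹' A ∩ V ⁻¹' B) = ∫⁻ v in B, ∫⁻ u in A, a (v, u) ∂volume ∂(P.map V)) :
    ∀ᵐ ω ∂P, ∫⁻ u, a (V ω, u) = 1 := by
  have : IsProbabilityMeasure (P.map V) := Measure.isProbabilityMeasure_map hV.aemeasurable
  refine ae_of_ae_map (p := fun v => ∫⁻ u, a (v, u) = 1) hV.aemeasurable ?_
  refine ae_eq_of_forall_setLIntegral_eq_of_sigmaFinite ha.lintegral_prod_right'
    measurable_const fun s hs _ => ?_
  have := h Set.univ s .univ hs
  simp only [Set.preimage_univ, Set.univ_inter, Measure.restrict_univ] at this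
  rw [← this, setLIntegral_one, Measure.map_apply hV hs]

end Density

section Mixing

variable {Ω : Type*} [MeasurableSpace Ω] {P : Measure Ω} [IsProbabilityMeasure P]
  {α β γ : Type*} [MeasurableSpace α] [MeasureSpace β] [MeasurableSpace γ]
  {Y : Ω → α} {W : Ω → β} {Z : Ω → γ}

theorem setLIntegral_le_iSup_of_indepFun [StandardBorelSpace α] [Nonempty α]
    (hY : Measurable Y) (hW : Measurable W) (hZ : Measurable Z) (hWZ : IndepFun W Z P)
    {fW : β → ℝ≥0∞} (hfW : Measurable fW) (hlaw : P.map W = volume.withDensity fW)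
    {φ : (α × β × γ) → ℝ≥0∞} (hφ : Measurable φ) {K C : Set γ} (hC : MeasurableSet C)
    (hCK : C ⊆ K) :
    ∫⁻ ω in Z ⁻¹' C, φ (Y ω, W ω, Z ω) ∂P
      ≤ (⨆ z ∈ K, ∫⁻ w, fW w * ⨆ y, φ (y, w, z)) * P (Z ⁻¹' C) := by
  set S := ⨆ z ∈ K, ∫⁻ w, fW w * ⨆ y, φ (y, w, z)
  have : IsProbabilityMeasure (P.map W) := Measure.isProbabilityMeasure_map hW.aemeasurable
  have : IsProbabilityMeasure (P.map Z) := Measure.isProbabilityMeasure_map hZ.aemeasurable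
  have hWZm : Measurable fun ω => (W ω, Z ω) := hW.prodMk hZ
  let κ := condDistrib Y (fun ω => (W ω, Z ω)) P
  let ψ : (β × γ) × α → ℝ≥0∞ := fun q => φ (q.2, q.1.1, q.1.2)
  have hψ : Measurable ψ := by fun_prop
  let m : β × γ → ℝ≥0∞ := fun p => ∫⁻ y, ψ (p, y) ∂(κ p)
  have hm : Measurable m := hψ.lintegral_kernel_prod_right'
  have hmle (w : β) (z : γ) : m (w, z) ≤ ⨆ y, φ (y, w, z) :=
    calc m (w, z) ≤ ∫⁻ _, (⨆ y, φ (y, w, z)) ∂(κ (w, z)) :=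
          lintegral_mono fun y => le_iSup (fun y => φ (y, w, z)) y
      _ = _ := by simp
  let J : β × γ → ℝ≥0∞ := fun p => C.indicator 1 p.2
  have hJ : Measurable J := (measurable_one.indicator hC).comp measurable_snd
  have hmS (z : γ) (hz : z ∈ K) : ∫⁻ w, m (w, z) ∂(P.map W) ≤ S := by
    have hmz : Measurable fun w => m (w, z) := hm.comp measurable_prodMk_right
    rw [hlaw, lintegral_withDensity_eq_lintegral_mul _ hfW hmz]
    refine le_trans (lintegral_mono fun w => ?_)
      (le_iSup₂ (f := fun z _ => ∫⁻ w, fW w * ⨆ y, φ (y, w, z)) z hz)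
    exact mul_le_mul_right (hmle w z) _
  calc ∫⁻ ω in Z ⁻¹' C, φ (Y ω, W ω, Z ω) ∂P
      = ∫⁻ ω, J (W ω, Z ω) * ψ ((W ω, Z ω), Y ω) ∂P := by
        rw [← lintegral_indicator (hZ hC)]
        refine lintegral_congr fun ω => ?_
        by_cases h : Z ω ∈ C <;> simp [J, ψ, h]
    _ = ∫⁻ q, J q.1 * ψ q ∂(P.map fun ω => ((W ω, Z ω), Y ω)) :=
        (lintegral_map (f := fun q => J q.1 * ψ q) (by fun_prop) (hWZm.prodMk hY)).symm
    _ = ∫⁻ p, J p * m p ∂(P.map fun ω => (W ω, Z ω)) := by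
        rw [← compProd_map_condDistrib hY.aemeasurable,
          Measure.lintegral_compProd (by fun_prop)]
        exact lintegral_congr fun p =>
          lintegral_const_mul (J p) (f := fun y => ψ (p, y)) (by fun_prop)
    _ = ∫⁻ z, ∫⁻ w, J (w, z) * m (w, z) ∂(P.map W) ∂(P.map Z) := by
        have hJm : Measurable fun p => J p * m p := hJ.mul hm
        rw [(indepFun_iff_map_prod_eq_prod_map_map hW.aemeasurable hZ.aemeasurable).1 hWZ,
          lintegral_prod_symm' _ hJm]
    _ ≤ ∫⁻ z, C.indicator (fun _ => S) z ∂(P.map Z) := by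
        refine lintegral_mono fun z => ?_
        by_cases h : z ∈ C
        · simpa [J, h] using hmS z (hCK h)
        · simp [J, h]
    _ = S * P (Z ⁻¹' C) := by
        rw [lintegral_indicator_const hC, Measure.map_apply hZ hC]

theorem exists_lintegral_condDensity_near [StandardBorelSpace α] [Nonempty α]
    (hY : Measurable Y) (hW : Measurable W) (hZ : Measurable Z) (hWZ : IndepFun W Z P)
    {fW : β → ℝ≥0∞} (hfW : Measurable fW) (hlaw : P.map W = volume.withDensity fW)
    {U : Ω → ℝ} (hU : Measurable U) {f : (α × β × γ) × ℝ → ℝ} (hf : Measurable f)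
    (h : ∀ (A : Set ℝ) (B : Set (α × β × γ)), MeasurableSet A → MeasurableSet B →
      P (U ⁻¹' A ∩ (fun ω => (Y ω, W ω, Z ω)) ⁻¹' B) =
        ∫⁻ v in B, ∫⁻ u in A, ENNReal.ofReal (f (v, u)) ∂volume ∂(P.map fun ω => (Y ω, W ω, Z ω)))
    (z₀ : γ) (K : Set γ) {g : (α × ℝ) × β → ℝ≥0∞} (hg : Measurable g) (hg1 : ∀ q, g q ≤ 1) :
    ∃ g' : α × β → ℝ≥0∞, Measurable g' ∧ (∀ q, g' q ≤ 1) ∧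
      ∀ C, MeasurableSet C → C ⊆ K →
        ∫⁻ ω in Z ⁻¹' C, g ((Y ω, U ω), W ω) ∂P ≤ ∫⁻ ω in Z ⁻¹' C, g' (Y ω, W ω) ∂P +
          2 * (⨆ z ∈ K, ∫⁻ w, fW w * ⨆ y, ∫⁻ u,
            ENNReal.ofReal |f ((y, w, z), u) - f ((y, w, z₀), u)|) * P (Z ⁻¹' C) ∧
        ∫⁻ ω in Z ⁻¹' C, g' (Y ω, W ω) ∂P ≤ ∫⁻ ω in Z ⁻¹' C, g ((Y ω, U ω), W ω) ∂P +
          2 * (⨆ z ∈ K, ∫⁻ w, fW w * ⨆ y, ∫⁻ u,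
            ENNReal.ofReal |f ((y, w, z), u) - f ((y, w, z₀), u)|) * P (Z ⁻¹' C) := by
  let b : (α × β) × ℝ → ℝ≥0∞ := fun q => ENNReal.ofReal (f ((q.1.1, q.1.2, z₀), q.2))
  have hb : Measurable b := by fun_prop
  let bg : (α × β) × ℝ → ℝ≥0∞ := fun q => b q * g ((q.1.1, q.2), q.1.2)
  have hbg : Measurable bg := by fun_prop
  let φ : α × β × γ → ℝ≥0∞ := fun v =>
    ∫⁻ u, ENNReal.ofReal |f (v, u) - f ((v.1, v.2.1, z₀), u)|
  have hD : Measurable fun q : (α × β × γ) × ℝ =>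
      ENNReal.ofReal |f q - f ((q.1.1, q.1.2.1, z₀), q.2)| := by
    refine ENNReal.measurable_ofReal.comp (Measurable.abs (by fun_prop))
  have hφ : Measurable φ := hD.lintegral_prod_right'
  let g' : α × β → ℝ≥0∞ := fun p => min 1 (∫⁻ u, b (p, u))⁻¹ * ∫⁻ u, bg (p, u)
  have hg' : Measurable g' :=
    (measurable_const.min hb.lintegral_prod_right'.inv).mul hbg.lintegral_prod_right'
  have hV : Measurable fun ω => (Y ω, W ω, Z ω) := hY.prodMk (hW.prodMk hZ)
  refine ⟨g', hg', fun p => ?_, fun C hC hCK => ?_⟩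
  · calc g' p ≤ (∫⁻ u, b (p, u))⁻¹ * ∫⁻ u, b (p, u) := by
          refine mul_le_mul' (min_le_right _ _) (lintegral_mono fun u => ?_)
          exact mul_le_of_le_one_right' (hg1 _)
      _ ≤ 1 := ENNReal.inv_mul_le_one _
  · have hone := ae_lintegral_condDensity_eq_one (a := fun q => ENNReal.ofReal (f q)) hV
      (by fun_prop) h
    have hS := setLIntegral_le_iSup_of_indepFun hY hW hZ hWZ hfW hlaw hφ hC hCK
    have heq : ∫⁻ ω in Z ⁻¹' C, g ((Y ω, U ω), W ω) ∂P =
        ∫⁻ ω in Z ⁻¹' C, ∫⁻ u, ENNReal.ofReal (f ((Y ω, W ω, Z ω), u)) *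
          g ((Y ω, u), W ω) ∂volume ∂P := by
      let G : (α × β × γ) × ℝ → ℝ≥0∞ := fun q =>
        C.indicator 1 q.1.2.2 * g ((q.1.1, q.2), q.1.2.1)
      have hI : Measurable (C.indicator (1 : γ → ℝ≥0∞)) := measurable_one.indicator hC
      have hG : Measurable G := by fun_prop
      have := lintegral_eq_of_condDensity (a := fun q => ENNReal.ofReal (f q)) hV hU
        (by fun_prop) h hG
      rw [← lintegral_indicator (hZ hC), ← lintegral_indicator (hZ hC)]
      convert! this using 2 with ω ω
      · ext ω
        by_cases h : Z ω ∈ C <;> simp [G, h]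
      · ext ω
        by_cases h : Z ω ∈ C <;> simp [G, h]
    have hpt : ∀ᵐ ω ∂P, _ := hone.mono fun ω hω =>
      lintegral_rescale_le (μ := volume) (A := fun u => ENNReal.ofReal (f ((Y ω, W ω, Z ω), u)))
        (B := fun u => b ((Y ω, W ω), u))
        (D := fun u => ENNReal.ofReal |f ((Y ω, W ω, Z ω), u) - f ((Y ω, W ω, z₀), u)|)
        (g := fun u => g ((Y ω, u), W ω))
        (hD.comp (measurable_prodMk_left (x := (Y ω, W ω, Z ω))))
        (fun u => ofReal_le_ofReal_add_ofReal_abs_sub _ _)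
        (fun u => by
          rw [abs_sub_comm]
          exact ofReal_le_ofReal_add_ofReal_abs_sub _ _)
        (fun u => hg1 _) hω.le
    have h2 : ∫⁻ ω in Z ⁻¹' C, 2 * φ (Y ω, W ω, Z ω) ∂P =
        2 * ∫⁻ ω in Z ⁻¹' C, φ (Y ω, W ω, Z ω) ∂P := lintegral_const_mul _ (hφ.comp hV)
    have h2m : Measurable fun ω => 2 * φ (Y ω, W ω, Z ω) := (hφ.comp hV).const_mul 2
    rw [heq, mul_assoc]
    constructor
    · calc _ ≤ ∫⁻ ω in Z ⁻¹' C, (g' (Y ω, W ω) + 2 * φ (Y ω, W ω, Z ω)) ∂P :=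
            lintegral_mono_ae (ae_restrict_of_ae (hpt.mono fun ω hω => hω.1))
        _ = _ := lintegral_add_right _ h2m
        _ ≤ _ := by rw [h2]; gcongr
    · calc _ ≤ ∫⁻ ω in Z ⁻¹' C, (_ + 2 * φ (Y ω, W ω, Z ω)) ∂P :=
            lintegral_mono_ae (ae_restrict_of_ae (hpt.mono fun ω hω => hω.2))
        _ = _ := lintegral_add_right _ h2m
        _ ≤ _ := by rw [h2]; gcongr

end Mixing

theorem measurable_finSnoc (s : ℕ) :
    Measurable fun q : (Fin s → ℝ) × ℝ => (Fin.snoc q.1 q.2 : Fin (s + 1) → ℝ) := by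
  refine measurable_pi_iff.2 fun j => ?_
  refine Fin.lastCases ?_ (fun i => ?_) j
  · simpa using measurable_snd
  · simpa [Function.comp_def] using (measurable_pi_apply i).comp measurable_fst

/-- A bounded function of `W` and of the first `s` coordinates of `Y` integrates over events
`Z ⁻¹' C` almost as if it were independent of `Z`. -/
theorem exists_setLIntegral_near_mul {Ω : Type*} [MeasurableSpace Ω] {P : Measure Ω}
    [IsProbabilityMeasure P] {β γ : Type*} [MeasureSpace β] [MeasurableSpace γ]
    {Y : ℕ → Ω → ℝ} {W : Ω → β} {Z : Ω → γ}
    (hY : ∀ j, Measurable (Y j)) (hW : Measurable W) (hZ : Measurable Z) (hWZ : IndepFun W Z P)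
    {fW : β → ℝ≥0∞} (hfW : Measurable fW) (hlaw : P.map W = volume.withDensity fW)
    {f : ∀ s : ℕ, ((Fin s → ℝ) × β × γ) × ℝ → ℝ} (hf : ∀ s, Measurable (f s)) (N : ℕ)
    (h : ∀ s < N, ∀ (A : Set ℝ) (B : Set ((Fin s → ℝ) × β × γ)),
      MeasurableSet A → MeasurableSet B →
      P (Y s ⁻¹' A ∩ (fun ω => ((fun j : Fin s => Y j ω), W ω, Z ω)) ⁻¹' B) =
        ∫⁻ v in B, ∫⁻ u in A, ENNReal.ofReal (f s (v, u)) ∂volume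
          ∂(P.map fun ω => ((fun j : Fin s => Y j ω), W ω, Z ω)))
    (z₀ : γ) (K : Set γ) (s : ℕ) (hs : s ≤ N) {g : (Fin s → ℝ) × β → ℝ≥0∞}
    (hg : Measurable g) (hg1 : ∀ q, g q ≤ 1) :
    ∃ c : ℝ≥0∞, c ≤ 1 ∧ ∀ C, MeasurableSet C → C ⊆ K →
      ∫⁻ ω in Z ⁻¹' C, g ((fun j : Fin s => Y j ω), W ω) ∂P ≤ c * P (Z ⁻¹' C) +
        2 * (∑ i ∈ Finset.range s, ⨆ z ∈ K, ∫⁻ w, fW w * ⨆ y, ∫⁻ u,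
          ENNReal.ofReal |f i ((y, w, z), u) - f i ((y, w, z₀), u)|) * P (Z ⁻¹' C) ∧
      c * P (Z ⁻¹' C) ≤ ∫⁻ ω in Z ⁻¹' C, g ((fun j : Fin s => Y j ω), W ω) ∂P +
        2 * (∑ i ∈ Finset.range s, ⨆ z ∈ K, ∫⁻ w, fW w * ⨆ y, ∫⁻ u,
          ENNReal.ofReal |f i ((y, w, z), u) - f i ((y, w, z₀), u)|) * P (Z ⁻¹' C) := by
  induction s with
  | zero =>
    let G : β → ℝ≥0∞ := fun w => g (Fin.elim0, w)
    have hG : Measurable G := hg.comp measurable_prodMk_left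
    refine ⟨∫⁻ ω, G (W ω) ∂P, ?_, fun C hC _ => ?_⟩
    · calc _ ≤ ∫⁻ _, 1 ∂P := lintegral_mono fun ω => hg1 _
        _ = 1 := by simp
    · have hI : Measurable (C.indicator (1 : γ → ℝ≥0∞)) := measurable_one.indicator hC
      have : ∫⁻ ω in Z ⁻¹' C, g ((fun j : Fin 0 => Y j ω), W ω) ∂P =
          (∫⁻ ω, G (W ω) ∂P) * P (Z ⁻¹' C) := by
        have key := lintegral_mul_eq_lintegral_mul_lintegral_of_indepFun (hG.comp hW)
          (hI.comp hZ) (hWZ.comp hG hI)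
        have hP : ∫⁻ ω, (C.indicator (1 : γ → ℝ≥0∞) ∘ Z) ω ∂P = P (Z ⁻¹' C) := by
          rw [← lintegral_indicator_one (hZ hC)]
          rfl
        rw [hP] at key
        change _ = (∫⁻ ω, (G ∘ W) ω ∂P) * _
        rw [← key, ← lintegral_indicator (hZ hC)]
        refine lintegral_congr fun ω => ?_
        have : (fun j : Fin 0 => Y j ω) = Fin.elim0 := Subsingleton.elim _ _
        by_cases h : Z ω ∈ C <;> simp [G, h, this]
      rw [this]
      exact ⟨le_self_add, le_self_add⟩
  | succ s ih =>
    have hYs : Measurable fun ω => (fun j : Fin s => Y j ω) := measurable_pi_iff.2 fun j => hY j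
    obtain ⟨g', hg', hg'1, hstep⟩ := exists_lintegral_condDensity_near hYs hW hZ hWZ hfW hlaw
      (hY s) (hf s) (h s hs) z₀ K (g := fun q => g (Fin.snoc q.1.1 q.1.2, q.2))
      (hg.comp (((measurable_finSnoc s).comp measurable_fst).prodMk measurable_snd))
      (fun q => hg1 _)
    obtain ⟨c, hc, hcC⟩ := ih (by omega) hg' hg'1
    refine ⟨c, hc, fun C hC hCK => ?_⟩
    obtain ⟨h1, h2⟩ := hstep C hC hCK
    obtain ⟨h3, h4⟩ := hcC C hC hCK
    have hsnoc (ω : Ω) : (Fin.snoc (fun j : Fin s => Y j ω) (Y s ω) : Fin (s + 1) → ℝ) =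
        fun j : Fin (s + 1) => Y j ω := by
      ext j
      refine Fin.lastCases ?_ (fun i => ?_) j <;> simp
    simp only [hsnoc] at h1 h2
    rw [Finset.sum_range_succ, mul_add, add_mul]
    constructor
    · refine h1.trans ?_
      rw [← add_assoc]
      gcongr
    · refine h4.trans ?_
      rw [add_comm (2 * _ * _) (2 * _ * _), ← add_assoc]
      gcongr

/-- If the probabilities `P (G ∩ H ∩ E)` and `P (G ∩ Hᶜ ∩ E)` are nearly proportional to those of
`H ∩ E` and `Hᶜ ∩ E`, then `G` and `H` are nearly uncorrelated. -/
theorem abs_inter_sub_mul_le {Ω : Type*} [MeasurableSpace Ω] {P : Measure Ω}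
    [IsProbabilityMeasure P] {G H E : Set Ω} (hH : MeasurableSet H)
    (hE : MeasurableSet E) {c S : ℝ} (hc : 0 ≤ c) (hc1 : c ≤ 1) (hS : 0 ≤ S)
    (h1 : |P.real (G ∩ (H ∩ E)) - c * P.real (H ∩ E)| ≤ 2 * S * P.real (H ∩ E))
    (h2 : |P.real (G ∩ (Hᶜ ∩ E)) - c * P.real (Hᶜ ∩ E)| ≤ 2 * S * P.real (Hᶜ ∩ E)) :
    |P.real (G ∩ H) - P.real G * P.real H| ≤ 2 * S + 4 * P.real Eᶜ := by
  have e1 : P.real (G ∩ H) = P.real (G ∩ (H ∩ E)) + P.real (G ∩ H ∩ Eᶜ) := by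
    rw [← Set.inter_assoc, ← measureReal_inter_add_sdiff (s := G ∩ H) hE]; rfl
  have e2 : P.real (G ∩ Hᶜ) = P.real (G ∩ (Hᶜ ∩ E)) + P.real (G ∩ Hᶜ ∩ Eᶜ) := by
    rw [← Set.inter_assoc, ← measureReal_inter_add_sdiff (s := G ∩ Hᶜ) hE]; rfl
  have e3 : P.real H = P.real (H ∩ E) + P.real (H ∩ Eᶜ) := by
    rw [← measureReal_inter_add_sdiff (s := H) hE]; rfl
  have e4 : P.real Hᶜ = P.real (Hᶜ ∩ E) + P.real (Hᶜ ∩ Eᶜ) := by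
    rw [← measureReal_inter_add_sdiff (s := Hᶜ) hE]; rfl
  have e5 : P.real G = P.real (G ∩ H) + P.real (G ∩ Hᶜ) := by
    rw [← measureReal_inter_add_sdiff (s := G) hH]; rfl
  have e6 : P.real Hᶜ = 1 - P.real H := probReal_compl_eq_one_sub hH
  have l1 : P.real (G ∩ H ∩ Eᶜ) ≤ P.real Eᶜ := measureReal_mono Set.inter_subset_right
  have l2 : P.real (G ∩ Hᶜ ∩ Eᶜ) ≤ P.real Eᶜ := measureReal_mono Set.inter_subset_right
  have l3 : P.real (H ∩ Eᶜ) ≤ P.real Eᶜ := measureReal_mono Set.inter_subset_right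
  have l4 : P.real (Hᶜ ∩ Eᶜ) ≤ P.real Eᶜ := measureReal_mono Set.inter_subset_right
  have n1 : 0 ≤ P.real (G ∩ H ∩ Eᶜ) := measureReal_nonneg
  have n2 : 0 ≤ P.real (G ∩ Hᶜ ∩ Eᶜ) := measureReal_nonneg
  have n3 : 0 ≤ P.real (H ∩ Eᶜ) := measureReal_nonneg
  have n4 : 0 ≤ P.real (Hᶜ ∩ Eᶜ) := measureReal_nonneg
  have n5 : 0 ≤ P.real (H ∩ E) := measureReal_nonneg
  have n6 : 0 ≤ P.real (Hᶜ ∩ E) := measureReal_nonneg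
  generalize P.real (G ∩ (H ∩ E)) = a1 at *
  generalize P.real (G ∩ (Hᶜ ∩ E)) = a2 at *
  generalize P.real (G ∩ H ∩ Eᶜ) = b1 at *
  generalize P.real (G ∩ Hᶜ ∩ Eᶜ) = b2 at *
  generalize P.real (G ∩ H) = gh at *
  generalize P.real (G ∩ Hᶜ) = gh' at *
  generalize P.real (H ∩ E) = p1 at *
  generalize P.real (Hᶜ ∩ E) = p2 at *
  generalize P.real (H ∩ Eᶜ) = d1 at *
  generalize P.real (Hᶜ ∩ Eᶜ) = d2 at *
  generalize P.real Eᶜ = ε at *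
  generalize P.real Hᶜ = q at *
  generalize P.real H = p at *
  generalize P.real G = r at *
  have hp0 : 0 ≤ p := by linarith
  have hq0 : 0 ≤ q := by linarith
  have hε : 0 ≤ ε := n3.trans l3
  have id1 : gh - r * p = q * (a1 - c * p1) - p * (a2 - c * p2) +
      (c * (p * d2 - q * d1) + (q * b1 - p * b2)) := by
    subst e5
    have hq : q = 1 - p := e6
    have hp1 : p1 = p - d1 := by linarith
    have hp2 : p2 = q - d2 := by linarith
    rw [hp1, hp2, e1, e2, hq]
    ring
  have m1 : |q * (a1 - c * p1)| ≤ q * (2 * S * p1) := by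
    rw [abs_mul, abs_of_nonneg hq0]; gcongr
  have m2 : |p * (a2 - c * p2)| ≤ p * (2 * S * p2) := by
    rw [abs_mul, abs_of_nonneg hp0]; gcongr
  have cross (x y : ℝ) (hx : 0 ≤ x) (hy : 0 ≤ y) (hx' : x ≤ ε) (hy' : y ≤ ε) :
      |q * x - p * y| ≤ ε := by
    rw [abs_le]
    constructor <;> nlinarith [mul_nonneg hq0 hx, mul_nonneg hp0 hy,
      mul_le_mul_of_nonneg_left hx' hq0, mul_le_mul_of_nonneg_left hy' hp0]
  have m3 : |c * (p * d2 - q * d1)| ≤ ε := by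
    rw [abs_mul, abs_of_nonneg hc, abs_sub_comm]
    exact (mul_le_of_le_one_left (abs_nonneg _) hc1).trans (cross d1 d2 n3 n4 l3 l4)
  have m4 := cross b1 b2 n1 n2 l1 l2
  have m5 : q * (2 * S * p1) + p * (2 * S * p2) ≤ 2 * S := by
    have hpq : p + q = 1 := by linarith
    have : q * p1 + p * p2 ≤ 1 := by
      nlinarith [mul_nonneg hq0 n3, mul_nonneg hp0 n4, sq_nonneg (p - q)]
    nlinarith
  rw [id1]
  have t1 := abs_add_le (q * (a1 - c * p1) - p * (a2 - c * p2))
    (c * (p * d2 - q * d1) + (q * b1 - p * b2))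
  have t2 := abs_sub (q * (a1 - c * p1)) (p * (a2 - c * p2))
  have t3 := abs_add_le (c * (p * d2 - q * d1)) (q * b1 - p * b2)
  linarith

/-- Proposition 2.1, inequality (7): if `W = (W_{t+1},…,W_{t+k−1})` is a random vector with
density `f_W` independent of the past `(X_t,…,X_{t−r₁})`, and `f_{s,k,t}` are the conditional
densities of `X_{t+k+s}` given `(X_{t+k},…,X_{t+k+s−1}, W, X_t,…,X_{t−r₁})`, then
`|P(G∩H) − P(G)P(H)| ≤ 2 Σ_{s=0}^{r₂} sup_{x∈ℰ} 𝔼_W( sup_{ȳ} ∫ D_{s,k,t}(y|ȳ,W,x) dy ) + 4P(Eᶜ)`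
for all `H ∈ σ(X_t,…,X_{t−r₁})`, `G ∈ σ(X_{t+k},…,X_{t+k+r₂})`, where
`D_{s,k,t}(y|ȳ,w,x) = |f_{s,k,t}(y|ȳ,w,x) − f_{s,k,t}(y|ȳ,w,0)|` and
`𝔼_W(g(W)) = ∫ g(w) f_W(w) dw`. -/
theorem arch_mixing_stmt2
    {Ω : Type*} [MeasurableSpace Ω] (P : Measure Ω) [IsProbabilityMeasure P]
    (X : ℤ → Ω → ℝ) (hX : ∀ s, Measurable (X s))
    (t : ℤ) (k : ℕ) (hk : 1 ≤ k) (r₁ r₂ : ℕ)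
    (Xpast : Ω → Fin (r₁ + 1) → ℝ)
    (hXpast : Xpast = fun ω (j : Fin (r₁ + 1)) => X (t - (j : ℕ)) ω)
    (Xfut : Ω → Fin (r₂ + 1) → ℝ)
    (hXfut : Xfut = fun ω (j : Fin (r₂ + 1)) => X (t + (k : ℤ) + (j : ℕ)) ω)
    (W : Ω → Fin (k - 1) → ℝ) (hWmeas : Measurable W)
    (fW : (Fin (k - 1) → ℝ) → ℝ) (hfW_nonneg : ∀ w, 0 ≤ fW w) (hfW_meas : Measurable fW)
    (hWlaw : Measure.map W P = volume.withDensity fun w => ENNReal.ofReal (fW w))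
    (hindep : IndepFun W Xpast P)
    (f : ℕ → ℝ → (ℕ → ℝ) → (Fin (k - 1) → ℝ) → (Fin (r₁ + 1) → ℝ) → ℝ)
    (hf_nonneg : ∀ s y ybar w x, 0 ≤ f s y ybar w x)
    (hf_meas : ∀ s, Measurable
      (fun q : ℝ × (ℕ → ℝ) × (Fin (k - 1) → ℝ) × (Fin (r₁ + 1) → ℝ) =>
        f s q.1 q.2.1 q.2.2.1 q.2.2.2))
    (hdens : ∀ s : ℕ, s ≤ r₂ →
      ∀ (A : Set ℝ) (B : Set ((Fin s → ℝ) × (Fin (k - 1) → ℝ) × (Fin (r₁ + 1) → ℝ))),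
        MeasurableSet A → MeasurableSet B →
        P ((fun ω => X (t + (k : ℤ) + (s : ℕ)) ω) ⁻¹' A ∩
            (fun ω => ((fun j : Fin s => X (t + (k : ℤ) + (j : ℕ)) ω), W ω, Xpast ω)) ⁻¹' B)
          = ∫⁻ v in B, ∫⁻ y in A, ENNReal.ofReal (f s y (padVec s v.1) v.2.1 v.2.2) ∂volume
              ∂(Measure.map
                  (fun ω => ((fun j : Fin s => X (t + (k : ℤ) + (j : ℕ)) ω), W ω, Xpast ω)) P))
    (η : Fin (r₁ + 1) → ℝ) (hη : ∀ j, 0 < η j)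
    (𝓔 : Set (Fin (r₁ + 1) → ℝ)) (h𝓔 : 𝓔 = {x | ∀ j, |x j| ≤ η j})
    (E : Set Ω) (hE : E = Xpast ⁻¹' 𝓔) :
    ∀ G H : Set Ω,
      MeasurableSet[MeasurableSpace.comap Xfut inferInstance] G →
      MeasurableSet[MeasurableSpace.comap Xpast inferInstance] H →
      ENNReal.ofReal |(P (G ∩ H)).toReal - (P G).toReal * (P H).toReal|
        ≤ 2 * ∑ s ∈ Finset.range (r₂ + 1),
            (⨆ x ∈ 𝓔, ∫⁻ w, ENNReal.ofReal (fW w) *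
              ⨆ ybar : Fin s → ℝ, ∫⁻ y : ℝ,
                ENNReal.ofReal
                  |f s y (padVec s ybar) w x - f s y (padVec s ybar) w 0|)
          + 4 * P Eᶜ := by
  intro G H hG hH
  have hXpast_m : Measurable Xpast := by
    rw [hXpast]; exact measurable_pi_iff.2 fun j => hX _
  have hXfut_m : Measurable Xfut := by
    rw [hXfut]; exact measurable_pi_iff.2 fun j => hX _
  have h𝓔m : MeasurableSet 𝓔 := by
    have : 𝓔 = ⋂ j, {x | |x j| ≤ η j} := by rw [h𝓔]; ext x; simp
    rw [this]
    exact MeasurableSet.iInter fun j =>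
      measurableSet_le (measurable_pi_apply j).abs measurable_const
  have hpad (s : ℕ) : Measurable (padVec s) := by
    refine measurable_pi_iff.2 fun n => ?_
    by_cases hn : n < s
    · simpa [padVec, hn] using measurable_pi_apply _
    · simp [padVec, hn]
  obtain ⟨G', hG', rfl⟩ := hG
  obtain ⟨H', hH', rfl⟩ := hH
  let F : ∀ s : ℕ, ((Fin s → ℝ) × (Fin (k - 1) → ℝ) × (Fin (r₁ + 1) → ℝ)) × ℝ → ℝ :=
    fun s q => f s q.2 (padVec s q.1.1) q.1.2.1 q.1.2.2
  have hF (s : ℕ) : Measurable (F s) :=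
    (hf_meas s).comp (measurable_snd.prodMk (((hpad s).comp
      (measurable_fst.comp measurable_fst)).prodMk (measurable_snd.comp measurable_fst)))
  set S := ∑ s ∈ Finset.range (r₂ + 1),
    (⨆ x ∈ 𝓔, ∫⁻ w, ENNReal.ofReal (fW w) *
      ⨆ ybar : Fin s → ℝ, ∫⁻ y : ℝ,
        ENNReal.ofReal
          |f s y (padVec s ybar) w x - f s y (padVec s ybar) w 0|) with hSdef
  obtain ⟨c, hc1, hc⟩ := exists_setLIntegral_near_mul
    (Y := fun j => X (t + (k : ℤ) + (j : ℕ))) (fun j => hX _) hWmeas hXpast_m hindep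
    hfW_meas.ennreal_ofReal hWlaw hF (r₂ + 1) (fun s hs => hdens s (by omega)) 0 𝓔
    (r₂ + 1) le_rfl (g := fun q => G'.indicator 1 q.1)
    ((measurable_one.indicator hG').comp measurable_fst)
    (fun q => Set.indicator_le_self' (by simp) _)
  by_cases hStop : S = ⊤
  · simp [hStop]
  have hctop : c ≠ ⊤ := (hc1.trans_lt ENNReal.one_lt_top).ne
  have near (C : Set (Fin (r₁ + 1) → ℝ)) (hC : MeasurableSet C) (hCE : C ⊆ 𝓔) :
      |P.real (Xfut ⁻¹' G' ∩ Xpast ⁻¹' C) - c.toReal * P.real (Xpast ⁻¹' C)|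
        ≤ 2 * S.toReal * P.real (Xpast ⁻¹' C) := by
    have hint : ∫⁻ ω in Xpast ⁻¹' C,
        G'.indicator 1 (fun j : Fin (r₂ + 1) => X (t + (k : ℤ) + (j : ℕ)) ω) ∂P =
        P (Xfut ⁻¹' G' ∩ Xpast ⁻¹' C) := by
      rw [← Measure.restrict_apply (hXfut_m hG'), ← lintegral_indicator_one (hXfut_m hG'), hXfut]
      rfl
    obtain ⟨h1, h2⟩ := hc C hC hCE
    rw [hint] at h1 h2
    change _ ≤ c * _ + 2 * S * _ at h1
    change _ ≤ _ + 2 * S * _ at h2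
    have h1' := ENNReal.toReal_mono (by finiteness) h1
    have h2' := ENNReal.toReal_mono (by finiteness) h2
    rw [ENNReal.toReal_add (by finiteness) (by finiteness)] at h1' h2'
    simp only [ENNReal.toReal_mul, ENNReal.toReal_ofNat] at h1' h2'
    rw [abs_le]
    simp only [measureReal_def]
    constructor <;> linarith
  have key := abs_inter_sub_mul_le (P := P) (hXpast_m hH') (hXpast_m h𝓔m)
    ENNReal.toReal_nonneg (ENNReal.toReal_mono ENNReal.one_ne_top hc1) S.toReal_nonneg
    (near (H' ∩ 𝓔) (hH'.inter h𝓔m) Set.inter_subset_right)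
    (near (H'ᶜ ∩ 𝓔) (hH'.compl.inter h𝓔m) Set.inter_subset_right)
  rw [← hE] at key
  refine (ENNReal.ofReal_le_ofReal key).trans_eq ?_
  rw [ENNReal.ofReal_add (by positivity) (by positivity), ENNReal.ofReal_mul (by norm_num),
    ENNReal.ofReal_mul (by norm_num), ENNReal.ofReal_toReal hStop, measureReal_def,
    ENNReal.ofReal_toReal (measure_ne_top _ _)]
  simp
end

section
/- Let G ∈ σ(X_future), and H, E ∈ σ(X_past), where E = {ω : X_past(ω) ∈ ℰ} with ℰ = {x ∈ ℝ^{r₁+1} : |x_j| ≤ η_j for all j} for a vector η of positive reals, G = {ω : X_future(ω) ∈ 𝒢} and H = {ω : X_past(ω) ∈ ℋ} for Borel sets 𝒢 ⊆ ℝ^{r₂+1}, ℋ ⊆ ℝ^{r₁+1}. Let κ be a conditional distribution of X_future given X_past and write P(G | X_past = x) := κ(x, 𝒢). Then |P(G ∩ H ∩ E) − P(G ∩ E)P(H)| ≤ 2 P(H) · sup_{x ∈ ℰ} |P(G | X_past = x) − P(G | X_past = 0)| + ( inf_{x ∈ ℰ} P(G | X_past = x) ) · { P(H)P(Eᶜ)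 + P(H ∩ Eᶜ) }. -/
open MeasureTheory ProbabilityTheory

/-- If `f` stays within `S` of a constant on `s`, it exceeds its infimum over `s` by at most
`2 * S`. -/
lemma le_iInf_add_two_mul_iSup_abs_sub {α : Type*} (s : Set α) (f : α → ENNReal)
    (hf : ∀ x, f x ≠ ⊤) (c : ℝ) {x : α} (hx : x ∈ s) :
    f x ≤ (⨅ y ∈ s, f y) + 2 * ⨆ y ∈ s, ENNReal.ofReal |(f y).toReal - c| := by
  rw [← tsub_le_iff_right]
  refine le_iInf₂ fun y hy => tsub_le_iff_right.2 ?_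
  have bound (z : α) (hz : z ∈ s) : ENNReal.ofReal |(f z).toReal - c| ≤
      ⨆ y ∈ s, ENNReal.ofReal |(f y).toReal - c| :=
    le_iSup₂ (f := fun y (_ : y ∈ s) => ENNReal.ofReal |(f y).toReal - c|) z hz
  calc f x = ENNReal.ofReal (f x).toReal := (ENNReal.ofReal_toReal (hf x)).symm
    _ ≤ ENNReal.ofReal ((f y).toReal + (|(f x).toReal - c| + |(f y).toReal - c|)) := by
        apply ENNReal.ofReal_le_ofReal
        linarith [le_abs_self ((f x).toReal - c), neg_abs_le ((f y).toReal - c)]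
    _ = f y + (ENNReal.ofReal |(f x).toReal - c| + ENNReal.ofReal |(f y).toReal - c|) := by
        rw [ENNReal.ofReal_add (by positivity) (by positivity),
          ENNReal.ofReal_add (by positivity) (by positivity), ENNReal.ofReal_toReal (hf y)]
    _ ≤ _ := by
        rw [two_mul]
        gcongr
        · exact bound x hx
        · exact bound y hy

/-- A covariance-type bound for a product of probabilities, when `p` and `q` are averages of a
function with values in `[m, m + T]` over sets of mass `a` and `e`. -/
lemma abs_sub_mul_le_of_oscillation {p q m T a b e d h : ℝ} (hm : 0 ≤ m) (hT : 0 ≤ T)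
    (hb : 0 ≤ b) (hd : 0 ≤ d) (hh : 0 ≤ h) (hab : a + b = h) (hed : e + d = 1)
    (hp : m * a ≤ p) (hp' : p ≤ (m + T) * a) (hq : m * e ≤ q) (hq' : q ≤ (m + T) * e) :
    |p - q * h| ≤ h * T + m * (h * d + b) := by
  obtain rfl : a = h - b := by linarith
  obtain rfl : e = 1 - d := by linarith
  have := mul_le_mul_of_nonneg_right hq hh
  have := mul_le_mul_of_nonneg_right hq' hh
  have := mul_nonneg hT hb
  have := mul_nonneg hm hb
  have := mul_nonneg (mul_nonneg hT hd) hh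
  have := mul_nonneg (mul_nonneg hm hd) hh
  rw [abs_le]
  constructor <;> linarith

/-- Lemma A.1: with `E = {X_past ∈ ℰ}` for `ℰ` a box defined by a positive vector `η`,
`G = {X_future ∈ 𝒢}`, `H = {X_past ∈ ℋ}` and `κ` a conditional distribution of `X_future`
given `X_past`,
`|P(G∩H∩E) − P(G∩E)P(H)| ≤ 2 P(H) sup_{x∈ℰ} |P(G|X_past=x) − P(G|X_past=0)|
  + (inf_{x∈ℰ} P(G|X_past=x)) (P(H)P(Eᶜ) + P(H∩Eᶜ))`. -/
theorem arch_mixing_stmt17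
    {Ω : Type*} [MeasurableSpace Ω] (P : Measure Ω) [IsProbabilityMeasure P]
    (r₁ r₂ : ℕ)
    (Xpast : Ω → Fin (r₁ + 1) → ℝ) (Xfut : Ω → Fin (r₂ + 1) → ℝ)
    (hXpast : Measurable Xpast) (hXfut : Measurable Xfut)
    (κ : Kernel (Fin (r₁ + 1) → ℝ) (Fin (r₂ + 1) → ℝ)) [IsMarkovKernel κ]
    (hκ : ∀ (A : Set (Fin (r₂ + 1) → ℝ)) (B : Set (Fin (r₁ + 1) → ℝ)),
      MeasurableSet A → MeasurableSet B →
      P (Xfut ⁻¹' A ∩ Xpast ⁻¹' B) = ∫⁻ x in B, κ x A ∂(Measure.map Xpast P))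
    (η : Fin (r₁ + 1) → ℝ) (hη : ∀ j, 0 < η j)
    (𝓔 : Set (Fin (r₁ + 1) → ℝ)) (h𝓔 : 𝓔 = {x | ∀ j, |x j| ≤ η j})
    (𝒢 : Set (Fin (r₂ + 1) → ℝ)) (h𝒢 : MeasurableSet 𝒢)
    (ℋ : Set (Fin (r₁ + 1) → ℝ)) (hℋ : MeasurableSet ℋ)
    (G H E : Set Ω)
    (hG : G = Xfut ⁻¹' 𝒢) (hH : H = Xpast ⁻¹' ℋ) (hE : E = Xpast ⁻¹' 𝓔) :
    ENNReal.ofReal |(P (G ∩ H ∩ E)).toReal - (P (G ∩ E)).toReal * (P H).toReal|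
      ≤ 2 * P H * (⨆ x ∈ 𝓔, ENNReal.ofReal |(κ x 𝒢).toReal - (κ 0 𝒢).toReal|)
        + (⨅ x ∈ 𝓔, κ x 𝒢) * (P H * P Eᶜ + P (H ∩ Eᶜ)) := by
  have h𝓔m : MeasurableSet 𝓔 := by
    rw [h𝓔, Set.ofPred_forall]
    exact MeasurableSet.iInter fun j =>
      measurableSet_le (measurable_pi_apply j).abs measurable_const
  have h0 : (0 : Fin (r₁ + 1) → ℝ) ∈ 𝓔 := by
    rw [h𝓔]
    exact fun j => by simpa using (hη j).le
  have hEm : MeasurableSet E := hE ▸ hXpast h𝓔m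
  set S := ⨆ x ∈ 𝓔, ENNReal.ofReal |(κ x 𝒢).toReal - (κ 0 𝒢).toReal| with hS
  set m := ⨅ x ∈ 𝓔, κ x 𝒢 with hm
  have hSt : S ≠ ⊤ := by
    refine ne_top_of_le_ne_top ENNReal.one_ne_top (iSup₂_le fun x _ => ?_)
    rw [ENNReal.ofReal_le_one]
    have h1 (y) : (κ y 𝒢).toReal ≤ 1 := measureReal_le_one
    rw [abs_le]
    constructor <;> linarith [h1 x, h1 0, (κ x 𝒢).toReal_nonneg, (κ 0 𝒢).toReal_nonneg]
  have hmt : m ≠ ⊤ := ne_top_of_le_ne_top (measure_ne_top (κ 0) 𝒢) (iInf₂_le 0 h0)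
  have key (B : Set (Fin (r₁ + 1) → ℝ)) (hB : MeasurableSet B) (hBE : B ⊆ 𝓔) :
      m.toReal * (P (Xpast ⁻¹' B)).toReal ≤ (P (Xfut ⁻¹' 𝒢 ∩ Xpast ⁻¹' B)).toReal ∧
      (P (Xfut ⁻¹' 𝒢 ∩ Xpast ⁻¹' B)).toReal
        ≤ (m.toReal + 2 * S.toReal) * (P (Xpast ⁻¹' B)).toReal := by
    have hT : m + 2 * S ≠ ⊤ := by finiteness
    have e : m.toReal + 2 * S.toReal = (m + 2 * S).toReal := by
      rw [ENNReal.toReal_add hmt (by finiteness), ENNReal.toReal_mul, ENNReal.toReal_ofNat]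
    rw [e, ← ENNReal.toReal_mul, ← ENNReal.toReal_mul,
      ENNReal.toReal_le_toReal (by finiteness) (by finiteness),
      ENNReal.toReal_le_toReal (by finiteness) (by finiteness), hκ 𝒢 B h𝒢 hB,
      ← Measure.map_apply hXpast hB, ← setLIntegral_const, ← setLIntegral_const]
    exact ⟨setLIntegral_mono' hB fun x hx => iInf₂_le x (hBE hx),
      setLIntegral_mono' hB fun x hx => le_iInf_add_two_mul_iSup_abs_sub 𝓔 (fun x => κ x 𝒢)
        (fun x => measure_ne_top _ _) _ (hBE hx)⟩
  obtain ⟨hq, hq'⟩ := key 𝓔 h𝓔m subset_rfl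
  obtain ⟨hp, hp'⟩ := key (ℋ ∩ 𝓔) (hℋ.inter h𝓔m) Set.inter_subset_right
  rw [Set.preimage_inter, ← Set.inter_assoc, ← hG, ← hH, ← hE] at hp hp'
  rw [← hG, ← hE] at hq hq'
  have main := abs_sub_mul_le_of_oscillation (T := 2 * S.toReal) m.toReal_nonneg (by positivity)
    (P (H ∩ Eᶜ)).toReal_nonneg (P Eᶜ).toReal_nonneg (P H).toReal_nonneg
    (by simpa only [Set.sdiff_eq, measureReal_def] using measureReal_inter_add_sdiff (μ := P) (s := H) hEm)
    (by simpa [measureReal_def] using measureReal_add_measureReal_compl (μ := P) hEm)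
    hp hp' hq hq'
  refine ENNReal.ofReal_le_of_le_toReal (main.trans_eq ?_)
  rw [ENNReal.toReal_add (by finiteness) (by finiteness), ENNReal.toReal_mul, ENNReal.toReal_mul,
    ENNReal.toReal_mul, ENNReal.toReal_add (by finiteness) (by finiteness), ENNReal.toReal_mul,
    ENNReal.toReal_ofNat]
  ring
end
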